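/- Fix smooth positive functions $a_{11}, a_{22}$ on $[0,\infty)$ bounded above and below by positive constants, a smooth bounded $b_1$, and let $V$ be a smooth solution on $\overline{\Omega}$, $\Omega=(0,L)\times(0,\infty)$, of the elliptic equation $-\partial_Y(a_{11}\partial_Y V) - \partial_x(a_{22}\partial_x V) + \partial_Y(b_1 V) = \partial_Y F$ with $V=0$ on $x=0$, $x=L$, $Y=0$, and with $V, \nabla V, \nabla^2 V$ decaying at $Y=\infty$. Then there is $L_0>0$ (depending only on the coefficient bounds) such that for $L\le L_0$: $\|V\|_{H^2(\Omega)} \le C\big(\|F\|_{L^2(\Omega)}+\|\partial_Y F\|_{L^2(\Omega)}\big)$ with $C$ depending only on the coefficient bounds. -/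

import Mathlib

open Set Filter MeasureTheory

/-- Partial derivative in the first variable. -/
noncomputable def pdX (U : ℝ → ℝ → ℝ) : ℝ → ℝ → ℝ := fun x Y => deriv (fun t => U t Y) x

/-- Partial derivative in the second variable. -/
noncomputable def pdY (U : ℝ → ℝ → ℝ) : ℝ → ℝ → ℝ := fun x Y => deriv (U x) Y

/-- Joint smoothness. -/
def Sm (U : ℝ → ℝ → ℝ) : Prop := ContDiff ℝ (⊤ : ℕ∞) (Function.uncurry U)

lemma Sm.fd {U : ℝ → ℝ → ℝ} (h : Sm U) (p : ℝ × ℝ) :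
    HasFDerivAt (Function.uncurry U) (fderiv ℝ (Function.uncurry U) p) p :=
  (ContDiff.differentiable h (by simp) p).hasFDerivAt

lemma Sm.hasX_aux {U : ℝ → ℝ → ℝ} (h : Sm U) (x Y : ℝ) :
    HasDerivAt (fun t => U t Y) (fderiv ℝ (Function.uncurry U) (x, Y) (1, 0)) x := by
  have h2 : HasDerivAt (fun t : ℝ => (t, Y)) ((1 : ℝ), (0 : ℝ)) x :=
    (hasDerivAt_id x).prodMk (hasDerivAt_const x Y)
  exact (h.fd (x, Y)).comp_hasDerivAt x h2

lemma Sm.hasY_aux {U : ℝ → ℝ → ℝ} (h : Sm U) (x Y : ℝ) :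
    HasDerivAt (U x) (fderiv ℝ (Function.uncurry U) (x, Y) (0, 1)) Y := by
  have h2 : HasDerivAt (fun t : ℝ => (x, t)) ((0 : ℝ), (1 : ℝ)) Y :=
    (hasDerivAt_const Y x).prodMk (hasDerivAt_id Y)
  exact (h.fd (x, Y)).comp_hasDerivAt Y h2

lemma Sm.pdX_eq {U : ℝ → ℝ → ℝ} (h : Sm U) (x Y : ℝ) :
    pdX U x Y = fderiv ℝ (Function.uncurry U) (x, Y) (1, 0) := (h.hasX_aux x Y).deriv

lemma Sm.pdY_eq {U : ℝ → ℝ → ℝ} (h : Sm U) (x Y : ℝ) :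
    pdY U x Y = fderiv ℝ (Function.uncurry U) (x, Y) (0, 1) := (h.hasY_aux x Y).deriv

lemma Sm.hasX {U : ℝ → ℝ → ℝ} (h : Sm U) (x Y : ℝ) :
    HasDerivAt (fun t => U t Y) (pdX U x Y) x := by
  rw [h.pdX_eq]; exact h.hasX_aux x Y

lemma Sm.hasY {U : ℝ → ℝ → ℝ} (h : Sm U) (x Y : ℝ) :
    HasDerivAt (fun t => U x t) (pdY U x Y) Y := by
  rw [h.pdY_eq]; exact h.hasY_aux x Y

lemma Sm.smX {U : ℝ → ℝ → ℝ} (h : Sm U) : Sm (pdX U) := by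
  have : Function.uncurry (pdX U) = fun p => fderiv ℝ (Function.uncurry U) p (1, 0) := by
    ext ⟨x, Y⟩; exact h.pdX_eq x Y
  unfold Sm; rw [this]
  exact (ContDiff.fderiv_right h (by simp)).clm_apply contDiff_const

lemma Sm.smY {U : ℝ → ℝ → ℝ} (h : Sm U) : Sm (pdY U) := by
  have : Function.uncurry (pdY U) = fun p => fderiv ℝ (Function.uncurry U) p (0, 1) := by
    ext ⟨x, Y⟩; exact h.pdY_eq x Y
  unfold Sm; rw [this]
  exact (ContDiff.fderiv_right h (by simp)).clm_apply contDiff_const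

lemma Sm.cont {U : ℝ → ℝ → ℝ} (h : Sm U) : Continuous (fun p : ℝ × ℝ => U p.1 p.2) :=
  ContDiff.continuous h

lemma Sm.comm {U : ℝ → ℝ → ℝ} (h : Sm U) : pdY (pdX U) = pdX (pdY U) := by
  have hX : Function.uncurry (pdX U) = fun p => fderiv ℝ (Function.uncurry U) p (1, 0) := by
    ext ⟨x, Y⟩; exact h.pdX_eq x Y
  have hY : Function.uncurry (pdY U) = fun p => fderiv ℝ (Function.uncurry U) p (0, 1) := by
    ext ⟨x, Y⟩; exact h.pdY_eq x Y
  have hd : Differentiable ℝ (fderiv ℝ (Function.uncurry U)) :=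
    (ContDiff.fderiv_right (m := (⊤ : ℕ∞)) h (by simp)).differentiable (by simp)
  ext x Y
  rw [h.smX.pdY_eq, h.smY.pdX_eq, hX, hY]
  have hs : IsSymmSndFDerivAt ℝ (Function.uncurry U) (x, Y) :=
    (ContDiff.contDiffAt h).isSymmSndFDerivAt (by simp only [minSmoothness_of_isRCLikeNormedField]; exact WithTop.coe_le_coe.2 le_top)
  rw [fderiv_clm_apply (hd _) (differentiableAt_const _),
    fderiv_clm_apply (hd _) (differentiableAt_const _)]
  simpa using hs (0, 1) (1, 0)

/-- The half strip. -/
abbrev Om (L : ℝ) : Set (ℝ × ℝ) := Ioo (0:ℝ) L ×ˢ Ioi (0:ℝ)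

lemma om_vol (L : ℝ) : (volume : Measure (ℝ × ℝ)).restrict (Om L) =
    ((volume : Measure ℝ).restrict (Ioo 0 L)).prod ((volume : Measure ℝ).restrict (Ioi 0)) := by
  rw [Measure.prod_restrict]; rfl

/-- Fibrewise integration by parts in `x`. -/
lemma int_pdX {L : ℝ} (hL : 0 < L) (Z Z' : ℝ → ℝ → ℝ)
    (hZ' : Continuous (fun p : ℝ × ℝ => Z' p.1 p.2))
    (hd : ∀ x Y, HasDerivAt (fun t => Z t Y) (Z' x Y) x)
    (hi' : IntegrableOn (fun p : ℝ × ℝ => Z' p.1 p.2) (Om L))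
    (h0 : ∀ Y, 0 < Y → Z 0 Y = 0) (h1 : ∀ Y, 0 < Y → Z L Y = 0) :
    ∫ p in Om L, Z' p.1 p.2 = 0 := by
  unfold IntegrableOn at hi'
  rw [om_vol] at hi' ⊢
  rw [integral_prod_symm _ hi']
  apply setIntegral_eq_zero_of_forall_eq_zero
  intro Y hY
  simp only
  rw [← integral_Ioc_eq_integral_Ioo, ← intervalIntegral.integral_of_le hL.le,
    intervalIntegral.integral_eq_sub_of_hasDerivAt (f := fun t => Z t Y) (fun x _ => hd x Y)
      ((hZ'.comp (by fun_prop : Continuous fun x : ℝ => (x, Y))).intervalIntegrable _ _)]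
  rw [h0 Y hY, h1 Y hY, sub_zero]

/-- Fibrewise integration by parts in `Y`. -/
lemma int_pdY {L : ℝ} (Z Z' : ℝ → ℝ → ℝ)
    (hd : ∀ x Y, HasDerivAt (fun t => Z x t) (Z' x Y) Y)
    (hi : IntegrableOn (fun p : ℝ × ℝ => Z p.1 p.2) (Om L))
    (hi' : IntegrableOn (fun p : ℝ × ℝ => Z' p.1 p.2) (Om L))
    (h0 : ∀ x ∈ Ioo (0:ℝ) L, Z x 0 = 0) :
    ∫ p in Om L, Z' p.1 p.2 = 0 := by
  unfold IntegrableOn at hi hi'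
  rw [om_vol] at hi hi' ⊢
  rw [integral_prod _ hi']
  apply integral_eq_zero_of_ae
  filter_upwards [hi.prod_right_ae, hi'.prod_right_ae, ae_restrict_mem measurableSet_Ioo]
    with x h1 h2 hx
  have ht := tendsto_zero_of_hasDerivAt_of_integrableOn_Ioi (fun Y _ => hd x Y) h2 h1
  have := integral_Ioi_of_hasDerivAt_of_tendsto (hd x 0).continuousAt.continuousWithinAt
    (fun Y _ => hd x Y) h2 ht
  simpa [h0 x hx] using this

/-- Differentiation under the integral over a compact interval. -/
lemma hasDerivAt_par {L : ℝ} (hL : 0 < L) (Z Z' : ℝ → ℝ → ℝ)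
    (hZ : Continuous (fun p : ℝ × ℝ => Z p.1 p.2))
    (hZ' : Continuous (fun p : ℝ × ℝ => Z' p.1 p.2))
    (hd : ∀ x Y, HasDerivAt (fun t => Z x t) (Z' x Y) Y) (Y : ℝ) :
    HasDerivAt (fun Y => ∫ x in (0:ℝ)..L, Z x Y) (∫ x in (0:ℝ)..L, Z' x Y) Y := by
  obtain ⟨B, hB⟩ := ((isCompact_Icc (a := (0:ℝ)) (b := L)).prod
    (isCompact_Icc (a := Y - 1) (b := Y + 1))).exists_bound_of_continuousOn hZ'.continuousOn
  have c1 : ∀ Y : ℝ, Continuous fun x : ℝ => (x, Y) := fun Y => by fun_prop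
  refine (intervalIntegral.hasDerivAt_integral_of_dominated_loc_of_deriv_le
    (F := fun Y x => Z x Y) (F' := fun Y x => Z' x Y) (s := Icc (Y-1) (Y+1))
    (bound := fun _ => B)
    (Icc_mem_nhds (by linarith) (by linarith)) ?_ ?_ ?_ ?_ ?_ ?_).2
  · exact Eventually.of_forall fun y => (hZ.comp (c1 y)).aestronglyMeasurable
  · exact (hZ.comp (c1 Y)).intervalIntegrable _ _
  · exact (hZ'.comp (c1 Y)).aestronglyMeasurable
  · refine Eventually.of_forall fun x hx y hy => ?_
    rw [uIoc_of_le hL.le] at hx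
    exact hB (x, y) ⟨⟨hx.1.le, hx.2⟩, hy⟩
  · exact intervalIntegrable_const
  · exact Eventually.of_forall fun x hx y hy => hd x y

/-- The key identity: `∫ V_{xY}² = ∫ V_{xx} V_{YY}`. -/
lemma key_identity {L : ℝ} (hL : 0 < L) (V : ℝ → ℝ → ℝ) (hV : Sm V)
    (hb : ∀ Y : ℝ, 0 ≤ Y → V 0 Y = 0 ∧ V L Y = 0)
    (hb0 : ∀ x ∈ Icc (0:ℝ) L, V x 0 = 0)
    (hi : IntegrableOn (fun p : ℝ × ℝ => pdX V p.1 p.2 * pdX (pdY V) p.1 p.2) (Om L))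
    (hi' : IntegrableOn (fun p : ℝ × ℝ => pdX (pdY V) p.1 p.2 ^ 2
      - pdX (pdX V) p.1 p.2 * pdY (pdY V) p.1 p.2) (Om L)) :
    ∫ p in Om L, (pdX (pdY V) p.1 p.2 ^ 2 - pdX (pdX V) p.1 p.2 * pdY (pdY V) p.1 p.2) = 0 := by
  have hc := hV.comm
  have hc2 := hV.smY.comm
  set W := pdX (pdY V) with hW
  have sW : Sm W := hV.smY.smX
  have c1 : ∀ Y : ℝ, Continuous fun x : ℝ => (x, Y) := fun Y => by fun_prop
  have hder : ∀ Y, HasDerivAt (fun Y => ∫ x in (0:ℝ)..L, pdX V x Y * W x Y)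
      (∫ x in (0:ℝ)..L, (W x Y * W x Y + pdX V x Y * pdY W x Y)) Y := by
    intro Y
    refine hasDerivAt_par hL (fun x Y => pdX V x Y * W x Y)
      (fun x Y => W x Y * W x Y + pdX V x Y * pdY W x Y) ?_ ?_ ?_ Y
    · exact hV.smX.cont.mul sW.cont
    · exact (sW.cont.mul sW.cont).add (hV.smX.cont.mul sW.smY.cont)
    · intro x Y
      have := (hV.smX.hasY x Y).mul (sW.hasY x Y)
      rw [hc] at this
      exact this
  have hzero : ∀ x₀, (∀ Y : ℝ, 0 ≤ Y → V x₀ Y = 0) → ∀ Y, 0 < Y → pdY (pdY V) x₀ Y = 0 := by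
    intro x₀ h Y hY
    have e1 : ∀ Y, 0 < Y → pdY V x₀ Y = 0 := by
      intro Y hY
      have : V x₀ =ᶠ[nhds Y] fun _ => 0 := by
        filter_upwards [Ioi_mem_nhds hY] with s hs using h s (le_of_lt hs)
      have := this.deriv_eq
      simpa [pdY] using this
    have : pdY V x₀ =ᶠ[nhds Y] fun _ => 0 := by
      filter_upwards [Ioi_mem_nhds hY] with s hs using e1 s hs
    have := this.deriv_eq
    simpa [pdY] using this
  have hx0 : ∀ x ∈ Ioo (0:ℝ) L, pdX V x 0 = 0 := by
    intro x hx
    have : (fun t => V t 0) =ᶠ[nhds x] fun _ => 0 := by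
      filter_upwards [Ioo_mem_nhds hx.1 hx.2] with s hs using hb0 s ⟨hs.1.le, hs.2.le⟩
    have := this.deriv_eq
    simpa [pdX] using this
  have hk : ∀ Y, 0 < Y → (∫ x in (0:ℝ)..L, (W x Y * W x Y + pdX V x Y * pdY W x Y))
      = ∫ x in Ioo 0 L, (W x Y ^ 2 - pdX (pdX V) x Y * pdY (pdY V) x Y) := by
    intro Y hY
    have cW : Continuous (fun x => W x Y) := sW.cont.comp (c1 Y)
    have cWY : Continuous (fun x => pdY W x Y) := sW.smY.cont.comp (c1 Y)
    have cX : Continuous (fun x => pdX V x Y) := hV.smX.cont.comp (c1 Y)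
    have cXX : Continuous (fun x => pdX (pdX V) x Y) := hV.smX.smX.cont.comp (c1 Y)
    have cYY : Continuous (fun x => pdY (pdY V) x Y) := hV.smY.smY.cont.comp (c1 Y)
    have hp := intervalIntegral.integral_mul_deriv_eq_deriv_mul (a := 0) (b := L)
      (u := fun x => pdX V x Y) (v := fun x => pdY (pdY V) x Y)
      (u' := fun x => pdX (pdX V) x Y) (v' := fun x => pdY W x Y)
      (fun x _ => hV.smX.hasX x Y) (fun x _ => by
        have := hV.smY.smY.hasX x Y
        rw [← hc2] at this; exact this)
      (cXX.intervalIntegrable _ _) (cWY.intervalIntegrable _ _)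
    have i1 : IntervalIntegrable (fun x => W x Y * W x Y) volume 0 L :=
      (cW.mul cW).intervalIntegrable _ _
    have i2 : IntervalIntegrable (fun x => pdX V x Y * pdY W x Y) volume 0 L :=
      (cX.mul cWY).intervalIntegrable _ _
    have i3 : IntervalIntegrable (fun x => W x Y ^ 2) volume 0 L :=
      (cW.pow 2).intervalIntegrable _ _
    have i4 : IntervalIntegrable (fun x => pdX (pdX V) x Y * pdY (pdY V) x Y) volume 0 L :=
      (cXX.mul cYY).intervalIntegrable _ _
    rw [← integral_Ioc_eq_integral_Ioo, ← intervalIntegral.integral_of_le hL.le,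
      intervalIntegral.integral_add i1 i2, intervalIntegral.integral_sub i3 i4, hp,
      hzero 0 (fun Y h => (hb Y h).1) Y hY, hzero L (fun Y h => (hb Y h).2) Y hY]
    simp only [pow_two]
    ring
  unfold IntegrableOn at hi hi'
  rw [om_vol] at hi hi' ⊢
  rw [integral_prod_symm _ hi']
  have I1 := hi.integral_prod_right
  have I2 := hi'.integral_prod_right
  have I1' : IntegrableOn (fun Y => ∫ x in (0:ℝ)..L, pdX V x Y * W x Y) (Ioi 0) := by
    refine I1.congr (Eventually.of_forall fun Y => ?_)
    simp only
    rw [← integral_Ioc_eq_integral_Ioo, ← intervalIntegral.integral_of_le hL.le]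
  have I2' : IntegrableOn
      (fun Y => ∫ x in (0:ℝ)..L, (W x Y * W x Y + pdX V x Y * pdY W x Y)) (Ioi 0) := by
    refine I2.congr ?_
    filter_upwards [ae_restrict_mem measurableSet_Ioi] with Y hY
    exact (hk Y hY).symm
  have ht := tendsto_zero_of_hasDerivAt_of_integrableOn_Ioi (fun Y _ => hder Y) I2' I1'
  have := integral_Ioi_of_hasDerivAt_of_tendsto (hder 0).continuousAt.continuousWithinAt
    (fun Y _ => hder Y) I2' ht
  rw [setIntegral_congr_fun measurableSet_Ioi (fun Y hY => (hk Y hY))] at this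
  simp only
  rw [this, intervalIntegral.integral_of_le hL.le, integral_Ioc_eq_integral_Ioo,
    setIntegral_eq_zero_of_forall_eq_zero, sub_zero]
  intro x hx
  rw [hx0 x hx, zero_mul]

lemma lincomb7 {α : Type*} [MeasurableSpace α] {μ : Measure α} {f1 f2 f3 f4 f5 f6 f7 T : α → ℝ}
    (h1 : Integrable f1 μ) (h2 : Integrable f2 μ) (h3 : Integrable f3 μ) (h4 : Integrable f4 μ)
    (h5 : Integrable f5 μ) (h6 : Integrable f6 μ) (h7 : Integrable f7 μ) (hT : Integrable T μ)
    (c1 c2 c3 c4 c5 c6 c7 : ℝ)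
    (h : ∀ᵐ p ∂μ, c1 * f1 p + c2 * f2 p + c3 * f3 p + c4 * f4 p + c5 * f5 p + c6 * f6 p
      + c7 * f7 p ≤ T p) :
    c1 * (∫ p, f1 p ∂μ) + c2 * (∫ p, f2 p ∂μ) + c3 * (∫ p, f3 p ∂μ) + c4 * (∫ p, f4 p ∂μ)
      + c5 * (∫ p, f5 p ∂μ) + c6 * (∫ p, f6 p ∂μ) + c7 * (∫ p, f7 p ∂μ) ≤ ∫ p, T p ∂μ := by
  have k1 := h1.const_mul c1
  have k2 := h2.const_mul c2
  have k3 := h3.const_mul c3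
  have k4 := h4.const_mul c4
  have k5 := h5.const_mul c5
  have k6 := h6.const_mul c6
  have k7 := h7.const_mul c7
  have l2 : Integrable (fun p => c1 * f1 p + c2 * f2 p) μ := k1.add k2
  have l3 : Integrable (fun p => c1 * f1 p + c2 * f2 p + c3 * f3 p) μ := l2.add k3
  have l4 : Integrable (fun p => c1 * f1 p + c2 * f2 p + c3 * f3 p + c4 * f4 p) μ := l3.add k4
  have l5 : Integrable (fun p => c1 * f1 p + c2 * f2 p + c3 * f3 p + c4 * f4 p + c5 * f5 p) μ :=
    l4.add k5
  have l6 : Integrable (fun p => c1 * f1 p + c2 * f2 p + c3 * f3 p + c4 * f4 p + c5 * f5 p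
      + c6 * f6 p) μ := l5.add k6
  have l7 : Integrable (fun p => c1 * f1 p + c2 * f2 p + c3 * f3 p + c4 * f4 p + c5 * f5 p
      + c6 * f6 p + c7 * f7 p) μ := l6.add k7
  have := integral_mono_ae l7 hT h
  rw [integral_add l6 k7, integral_add l5 k6, integral_add l4 k5, integral_add l3 k4,
    integral_add l2 k3, integral_add k1 k2] at this
  simpa only [integral_const_mul] using this

lemma int_prod3 {L K : ℝ} {a f g : ℝ × ℝ → ℝ} (ha : Continuous a) (hf : Continuous f)
    (hg : Continuous g) (hK : ∀ p ∈ Om L, |a p| ≤ K)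
    (i1 : IntegrableOn (fun p => f p ^ 2) (Om L)) (i2 : IntegrableOn (fun p => g p ^ 2) (Om L)) :
    IntegrableOn (fun p => a p * (f p * g p)) (Om L) := by
  refine Integrable.mono' ((i1.add i2).const_mul K) (by fun_prop) ?_
  filter_upwards [ae_restrict_mem (measurableSet_Ioo.prod measurableSet_Ioi)] with p hp
  have h1 := hK p hp
  have h0 : 0 ≤ K := (abs_nonneg _).trans h1
  rw [Real.norm_eq_abs, abs_mul]
  have h2 : |f p * g p| ≤ f p ^ 2 + g p ^ 2 := by
    rw [abs_le]; constructor <;> nlinarith [sq_nonneg (f p + g p), sq_nonneg (f p - g p)]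
  exact mul_le_mul h1 h2 (abs_nonneg _) h0

lemma pt_poin {x L v w : ℝ} (hx0 : 0 < x) (hxL : x < L) :
    1 / 2 * v ^ 2 + -(2 * L ^ 2) * w ^ 2 ≤ v * v + 2 * x * (v * w) := by
  have : x ^ 2 * w ^ 2 ≤ L ^ 2 * w ^ 2 :=
    mul_le_mul_of_nonneg_right (by nlinarith) (sq_nonneg w)
  nlinarith [sq_nonneg (v + 2 * x * w)]

lemma pt_energy {c0 Cb a d b a' b' v vx vy xx yy G : ℝ} (hc0 : 0 < c0) (ha : c0 ≤ a) (hd : c0 ≤ d)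
    (hb : |b| ≤ Cb) (hb' : |b'| ≤ Cb)
    (he : -(a' * vy + a * yy) - d * xx + (b' * v + b * vy) = G) :
    -(1 / 2 + Cb + Cb ^ 2 / (2 * c0)) * v ^ 2 + c0 * vx ^ 2 + c0 / 2 * vy ^ 2 + -(1 / 2) * G ^ 2
      ≤ (a' * (vy * v) + a * (yy * v) + a * (vy * vy)) + (d * (xx * v) + d * (vx * vx)) := by
  have e : (a' * (vy * v) + a * (yy * v) + a * (vy * vy)) + (d * (xx * v) + d * (vx * vx))
      = a * vy ^ 2 + d * vx ^ 2 + b' * v ^ 2 + b * v * vy - v * G := by rw [← he]; ring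
  rw [e]
  have h1 : c0 * vy ^ 2 ≤ a * vy ^ 2 := by gcongr
  have h2 : c0 * vx ^ 2 ≤ d * vx ^ 2 := by gcongr
  have h3 : -Cb * v ^ 2 ≤ b' * v ^ 2 :=
    mul_le_mul_of_nonneg_right (abs_le.1 hb').1 (sq_nonneg v)
  have h4 : v * G ≤ 1 / 2 * v ^ 2 + 1 / 2 * G ^ 2 := by nlinarith [sq_nonneg (v - G)]
  have h5 : -(c0 / 2 * vy ^ 2) - Cb ^ 2 / (2 * c0) * v ^ 2 ≤ b * v * vy := by
    have hbb : b ^ 2 ≤ Cb ^ 2 := sq_le_sq' (abs_le.1 hb).1 (abs_le.1 hb).2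
    have : b ^ 2 / (2 * c0) * v ^ 2 ≤ Cb ^ 2 / (2 * c0) * v ^ 2 := by gcongr
    have e2 : c0 / 2 * vy ^ 2 + b ^ 2 / (2 * c0) * v ^ 2 + b * v * vy
        = (c0 * vy + b * v) ^ 2 / (2 * c0) := by field_simp; ring
    have : 0 ≤ (c0 * vy + b * v) ^ 2 / (2 * c0) := by positivity
    linarith
  linarith

lemma pt_g {Cb a d b a' b' v vy xx yy G : ℝ} 
    (ha' : |a'| ≤ Cb) (hb : |b| ≤ Cb) (hb' : |b'| ≤ Cb)
    (he : -(a' * vy + a * yy) - d * xx + (b' * v + b * vy) = G) :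
    (a * yy + d * xx) ^ 2 ≤ 4 * (G ^ 2 + 2 * Cb ^ 2 * vy ^ 2 + Cb ^ 2 * v ^ 2) := by
  have e : a * yy + d * xx = -G - a' * vy + b' * v + b * vy := by linarith
  rw [e]
  have q : ∀ t s : ℝ, |t| ≤ Cb → (t * s) ^ 2 ≤ Cb ^ 2 * s ^ 2 := by
    intro t s h
    rw [mul_pow]
    have : t ^ 2 ≤ Cb ^ 2 := sq_le_sq' (abs_le.1 h).1 (abs_le.1 h).2
    gcongr
  have h1 := q a' vy ha'
  have h2 := q b' v hb'
  have h3 := q b vy hb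
  generalize a' * vy = p at *
  generalize b' * v = r at *
  generalize b * vy = s at *
  nlinarith [sq_nonneg (G - p), sq_nonneg (G + r), sq_nonneg (G + s), sq_nonneg (p + r),
    sq_nonneg (p + s), sq_nonneg (r - s)]

lemma pt_h2 {c0 Cb a d xx yy H : ℝ} (hc0 : 0 < c0) (hCb : 0 < Cb) (ha : c0 ≤ a) (hd : c0 ≤ d)
    (hd' : d ≤ Cb) (hH : (a * yy + d * xx) ^ 2 ≤ 4 * H) :
    c0 / Cb / 2 * yy ^ 2 - 2 / (c0 / Cb * c0 ^ 2) * H ≤ -(xx * yy) := by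
  have hdp : 0 < d := hc0.trans_le hd
  set r := c0 / Cb with hr
  have hrp : 0 < r := by positivity
  have hq : r ≤ a / d := by
    rw [hr]; exact div_le_div₀ (hc0.le.trans ha) ha hdp hd'
  set u := (a * yy + d * xx) / d with hu
  have e : -(xx * yy) = a / d * yy ^ 2 - u * yy := by rw [hu]; field_simp; ring
  have hu2 : u ^ 2 ≤ 4 * H / c0 ^ 2 := by
    rw [hu, div_pow]
    have : c0 ^ 2 ≤ d ^ 2 := by gcongr
    exact div_le_div₀ ((sq_nonneg _).trans hH) hH (by positivity) this
  have h1 : r * yy ^ 2 ≤ a / d * yy ^ 2 := by gcongr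
  have h2 : u * yy ≤ r / 2 * yy ^ 2 + u ^ 2 / (2 * r) := by
    have e2 : r / 2 * yy ^ 2 + u ^ 2 / (2 * r) - u * yy = (r * yy - u) ^ 2 / (2 * r) := by
      field_simp; ring
    have : 0 ≤ (r * yy - u) ^ 2 / (2 * r) := by positivity
    linarith
  have h3 : u ^ 2 / (2 * r) ≤ 2 / (r * c0 ^ 2) * H := by
    calc u ^ 2 / (2 * r) ≤ (4 * H / c0 ^ 2) / (2 * r) := by gcongr
      _ = _ := by field_simp; ring
  rw [e]; linarith

lemma pt_xx {c0 Cb a d xx yy H : ℝ} (hc0 : 0 < c0) (ha : c0 ≤ a) (ha' : a ≤ Cb) (hd : c0 ≤ d)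
    (hH : (a * yy + d * xx) ^ 2 ≤ 4 * H) :
    c0 ^ 2 * xx ^ 2 ≤ 8 * H + 2 * Cb ^ 2 * yy ^ 2 := by
  have h1 : c0 ^ 2 * xx ^ 2 ≤ d ^ 2 * xx ^ 2 := by gcongr
  have h2 : a ^ 2 * yy ^ 2 ≤ Cb ^ 2 * yy ^ 2 := by
    have : 0 ≤ a := hc0.le.trans ha
    gcongr
  nlinarith [sq_nonneg ((a * yy + d * xx) + a * yy)]

lemma final_arith {c0 Cb K L h r κ A B D E M N G : ℝ} (hc0 : 0 < c0) (hr : 0 < r) (hκ : 0 < κ)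
    (hK : 1 / 2 ≤ K) (hL : 16 * L ^ 2 * K ≤ c0) (hh : h = 1 + 2 * Cb ^ 2 / c0 + Cb ^ 2)
    (hA : 0 ≤ A) (hB : 0 ≤ B) (hD : 0 ≤ D) (hE : 0 ≤ E) (hM : 0 ≤ M) (hG : 0 ≤ G)
    (e1 : 1 / 2 * D - 2 * L ^ 2 * B ≤ 0)
    (e2 : -K * D + c0 * B + c0 / 2 * A - 1 / 2 * G ≤ 0)
    (e3 : M + r / 2 * E - κ * (G + 2 * Cb ^ 2 * A + Cb ^ 2 * D) ≤ 0)
    (e4 : c0 ^ 2 * N ≤ 8 * (G + 2 * Cb ^ 2 * A + Cb ^ 2 * D) + 2 * Cb ^ 2 * E) :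
    D + B + A + N + M + E ≤ (1 + 1 / c0 + 1 / c0 + (8 * h + 2 * Cb ^ 2 * (2 * κ * h / r)) / c0 ^ 2
      + κ * h + 2 * κ * h / r) * G := by
  have hKD : K * D ≤ c0 / 4 * B := by
    have h1 : K * D ≤ K * (4 * L ^ 2 * B) := by gcongr; linarith
    have h2 : 16 * L ^ 2 * K * B ≤ c0 * B := by gcongr
    nlinarith
  have hA' : A ≤ 1 / c0 * G := by
    rw [one_div, ← div_eq_inv_mul, le_div_iff₀ hc0]; nlinarith
  have hB' : B ≤ 1 / c0 * G := by
    rw [one_div, ← div_eq_inv_mul, le_div_iff₀ hc0]; nlinarith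
  have hD' : D ≤ G := by
    have : c0 * B ≤ G := by
      have := mul_le_mul_of_nonneg_left hB' hc0.le
      have e : c0 * (1 / c0 * G) = G := by field_simp
      linarith
    nlinarith
  have hH : G + 2 * Cb ^ 2 * A + Cb ^ 2 * D ≤ h * G := by
    have h1 : 2 * Cb ^ 2 * A ≤ 2 * Cb ^ 2 * (1 / c0 * G) := by gcongr
    have h2 : Cb ^ 2 * D ≤ Cb ^ 2 * G := by gcongr
    have e : h * G = G + 2 * Cb ^ 2 * (1 / c0 * G) + Cb ^ 2 * G := by rw [hh]; ring
    linarith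
  have hκH := mul_le_mul_of_nonneg_left hH hκ.le
  have hM' : M ≤ κ * h * G := by
    have : 0 ≤ r / 2 * E := by positivity
    linarith
  have hE' : E ≤ 2 * κ * h / r * G := by
    rw [div_mul_eq_mul_div, le_div_iff₀ hr]; linarith
  have hN' : N ≤ (8 * h + 2 * Cb ^ 2 * (2 * κ * h / r)) / c0 ^ 2 * G := by
    rw [div_mul_eq_mul_div, le_div_iff₀ (by positivity)]
    have : 2 * Cb ^ 2 * E ≤ 2 * Cb ^ 2 * (2 * κ * h / r * G) := by gcongr
    linarith
  linarith

lemma core_est {c0 Cb L : ℝ} (hc0 : 0 < c0) (hCb : c0 ≤ Cb) (hL : 0 < L)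
    (hL0 : 16 * L ^ 2 * (1 / 2 + Cb + Cb ^ 2 / (2 * c0)) ≤ c0)
    {a11 a22 b1 : ℝ → ℝ} {V F : ℝ → ℝ → ℝ}
    (sa : ContDiff ℝ (⊤ : ℕ∞) a11) (sd : ContDiff ℝ (⊤ : ℕ∞) a22) (sb : ContDiff ℝ (⊤ : ℕ∞) b1)
    (hc : ∀ Y : ℝ, c0 ≤ a11 Y ∧ a11 Y ≤ Cb ∧ c0 ≤ a22 Y ∧ a22 Y ≤ Cb ∧ |b1 Y| ≤ Cb)
    (hc' : ∀ Y : ℝ, |deriv a11 Y| ≤ Cb ∧ |deriv a22 Y| ≤ Cb ∧ |deriv b1 Y| ≤ Cb)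
    (hV : Sm V) 
    (heq : ∀ x ∈ Ioo (0:ℝ) L, ∀ Y ∈ Ioi (0:ℝ),
      -(deriv (fun s => a11 s * deriv (V x) s) Y) - a22 Y * pdX (pdX V) x Y
        + deriv (fun s => b1 s * V x s) Y = pdY F x Y)
    (hb : ∀ Y : ℝ, 0 ≤ Y → V 0 Y = 0 ∧ V L Y = 0)
    (hb0 : ∀ x ∈ Icc (0:ℝ) L, V x 0 = 0)
    (iG : IntegrableOn (fun p : ℝ × ℝ => pdY F p.1 p.2 ^ 2) (Om L))
    (iS : IntegrableOn (fun p : ℝ × ℝ => V p.1 p.2 ^ 2 + pdX V p.1 p.2 ^ 2 + pdY V p.1 p.2 ^ 2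
      + pdX (pdX V) p.1 p.2 ^ 2 + pdX (pdY V) p.1 p.2 ^ 2 + pdY (pdY V) p.1 p.2 ^ 2) (Om L))
    {h r κ : ℝ} (hh : h = 1 + 2 * Cb ^ 2 / c0 + Cb ^ 2) (hr : r = c0 / Cb)
    (hκ : κ = 2 / (r * c0 ^ 2)) :
    ∫ p in Om L, (V p.1 p.2 ^ 2 + pdX V p.1 p.2 ^ 2 + pdY V p.1 p.2 ^ 2
      + pdX (pdX V) p.1 p.2 ^ 2 + pdX (pdY V) p.1 p.2 ^ 2 + pdY (pdY V) p.1 p.2 ^ 2)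
    ≤ (1 + 1 / c0 + 1 / c0 + (8 * h + 2 * Cb ^ 2 * (2 * κ * h / r)) / c0 ^ 2
      + κ * h + 2 * κ * h / r) * ∫ p in Om L, pdY F p.1 p.2 ^ 2 := by
  have hCb0 : 0 < Cb := hc0.trans_le hCb
  have mO : MeasurableSet (Om L) := measurableSet_Ioo.prod measurableSet_Ioi
  have hae : ∀ᵐ p ∂(volume : Measure (ℝ × ℝ)).restrict (Om L), p ∈ Om L := ae_restrict_mem mO
  -- the equation, expanded
  have he : ∀ p ∈ Om L, -(deriv a11 p.2 * pdY V p.1 p.2 + a11 p.2 * pdY (pdY V) p.1 p.2)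
      - a22 p.2 * pdX (pdX V) p.1 p.2 + (deriv b1 p.2 * V p.1 p.2 + b1 p.2 * pdY V p.1 p.2)
      = pdY F p.1 p.2 := by
    rintro ⟨x, Y⟩ ⟨hx, hY⟩
    have d1 := ((sa.differentiable (by simp) Y).hasDerivAt.mul (hV.smY.hasY x Y)).deriv
    have d2 := ((sb.differentiable (by simp) Y).hasDerivAt.mul (hV.hasY x Y)).deriv
    rw [← heq x hx Y hY]
    have hdera : deriv (fun s => a11 s * deriv (V x) s) Y
        = deriv a11 Y * pdY V x Y + a11 Y * pdY (pdY V) x Y := d1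
    have hderb : deriv (fun s => b1 s * V x s) Y
        = deriv b1 Y * V x Y + b1 Y * pdY V x Y := d2
    rw [hdera, hderb]
  -- continuity
  have cV := hV.cont
  have cX := hV.smX.cont
  have cY := hV.smY.cont
  have cXX := hV.smX.smX.cont
  have cXY := hV.smY.smX.cont
  have cYY := hV.smY.smY.cont
  have ca : Continuous fun p : ℝ × ℝ => a11 p.2 := sa.continuous.comp continuous_snd
  have cd : Continuous fun p : ℝ × ℝ => a22 p.2 := sd.continuous.comp continuous_snd
  have ca' : Continuous fun p : ℝ × ℝ => deriv a11 p.2 :=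
    (sa.continuous_deriv (by simp)).comp continuous_snd
  have ba : ∀ p ∈ Om L, |a11 p.2| ≤ Cb := fun p _ => by
    have := hc p.2; rw [abs_le]; constructor <;> linarith
  have bd : ∀ p ∈ Om L, |a22 p.2| ≤ Cb := fun p _ => by
    have := hc p.2; rw [abs_le]; constructor <;> linarith
  have ba' : ∀ p ∈ Om L, |deriv a11 p.2| ≤ Cb := fun p _ => (hc' p.2).1
  -- integrability of squares
  have sq_int : ∀ f : ℝ × ℝ → ℝ, Continuous f → (∀ p : ℝ × ℝ, f p ^ 2 ≤
      V p.1 p.2 ^ 2 + pdX V p.1 p.2 ^ 2 + pdY V p.1 p.2 ^ 2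
      + pdX (pdX V) p.1 p.2 ^ 2 + pdX (pdY V) p.1 p.2 ^ 2 + pdY (pdY V) p.1 p.2 ^ 2) →
      IntegrableOn (fun p => f p ^ 2) (Om L) := by
    intro f hf hle
    refine Integrable.mono' iS (by fun_prop) (Eventually.of_forall fun p => ?_)
    rw [Real.norm_of_nonneg (sq_nonneg _)]; exact hle p
  have iV := sq_int _ cV (fun p => by
    nlinarith only [sq_nonneg (pdX V p.1 p.2),
      sq_nonneg (pdY V p.1 p.2), sq_nonneg (pdX (pdX V) p.1 p.2), sq_nonneg (pdX (pdY V) p.1 p.2),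
      sq_nonneg (pdY (pdY V) p.1 p.2)])
  have iX := sq_int _ cX (fun p => by
    nlinarith only [sq_nonneg (V p.1 p.2),
      sq_nonneg (pdY V p.1 p.2), sq_nonneg (pdX (pdX V) p.1 p.2), sq_nonneg (pdX (pdY V) p.1 p.2),
      sq_nonneg (pdY (pdY V) p.1 p.2)])
  have iY := sq_int _ cY (fun p => by
    nlinarith only [sq_nonneg (V p.1 p.2),
      sq_nonneg (pdX V p.1 p.2), sq_nonneg (pdX (pdX V) p.1 p.2), sq_nonneg (pdX (pdY V) p.1 p.2),
      sq_nonneg (pdY (pdY V) p.1 p.2)])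
  have iXX := sq_int _ cXX (fun p => by
    nlinarith only [sq_nonneg (V p.1 p.2),
      sq_nonneg (pdX V p.1 p.2), sq_nonneg (pdY V p.1 p.2), sq_nonneg (pdX (pdY V) p.1 p.2),
      sq_nonneg (pdY (pdY V) p.1 p.2)])
  have iXY := sq_int _ cXY (fun p => by
    nlinarith only [sq_nonneg (V p.1 p.2),
      sq_nonneg (pdX V p.1 p.2), sq_nonneg (pdY V p.1 p.2), sq_nonneg (pdX (pdX V) p.1 p.2),
      sq_nonneg (pdY (pdY V) p.1 p.2)])
  have iYY := sq_int _ cYY (fun p => by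
    nlinarith only [sq_nonneg (V p.1 p.2),
      sq_nonneg (pdX V p.1 p.2), sq_nonneg (pdY V p.1 p.2), sq_nonneg (pdX (pdX V) p.1 p.2),
      sq_nonneg (pdX (pdY V) p.1 p.2)])
  have one_b : ∀ p ∈ Om L, |(fun _ : ℝ × ℝ => (1:ℝ)) p| ≤ 1 := fun p _ => by simp
  have prod_int : ∀ f g : ℝ × ℝ → ℝ, Continuous f → Continuous g →
      IntegrableOn (fun p => f p ^ 2) (Om L) → IntegrableOn (fun p => g p ^ 2) (Om L) →
      IntegrableOn (fun p => f p * g p) (Om L) := by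
    intro f g hf hg i1 i2
    simpa using int_prod3 (continuous_const (y := (1:ℝ))) hf hg one_b i1 i2
  -- Poincare
  have iT1 : IntegrableOn (fun p : ℝ × ℝ => V p.1 p.2 * V p.1 p.2
      + 2 * p.1 * (V p.1 p.2 * pdX V p.1 p.2)) (Om L) := by
    refine Integrable.add (prod_int _ _ cV cV iV iV) ?_
    refine int_prod3 (K := 2 * L) (a := fun p => 2 * p.1) (by fun_prop) cV cX ?_ iV iX
    rintro ⟨x, Y⟩ ⟨hx, -⟩
    have := hx.1; have := hx.2
    rw [abs_le]; constructor <;> simp only at * <;> linarith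
  have T1 : ∫ p in Om L, (V p.1 p.2 * V p.1 p.2
      + 2 * p.1 * (V p.1 p.2 * pdX V p.1 p.2)) = 0 := by
    refine int_pdX hL (fun x Y => x * (V x Y * V x Y))
      (fun x Y => V x Y * V x Y + 2 * x * (V x Y * pdX V x Y)) (by fun_prop) ?_ iT1 ?_ ?_
    · intro x Y
      have := (hasDerivAt_id x).mul ((hV.hasX x Y).mul (hV.hasX x Y))
      refine this.congr_deriv ?_
      simp only [id, Pi.mul_apply]; ring
    · intro Y hY; simp
    · intro Y hY; simp [(hb Y hY.le).2]
  -- energy, Y part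
  have iP : IntegrableOn (fun p : ℝ × ℝ => deriv a11 p.2 * (pdY V p.1 p.2 * V p.1 p.2)
      + a11 p.2 * (pdY (pdY V) p.1 p.2 * V p.1 p.2)
      + a11 p.2 * (pdY V p.1 p.2 * pdY V p.1 p.2)) (Om L) :=
    ((int_prod3 ca' cY cV ba' iY iV).add (int_prod3 ca cYY cV ba iYY iV)).add
      (int_prod3 ca cY cY ba iY iY)
  have TP : ∫ p in Om L, (deriv a11 p.2 * (pdY V p.1 p.2 * V p.1 p.2)
      + a11 p.2 * (pdY (pdY V) p.1 p.2 * V p.1 p.2)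
      + a11 p.2 * (pdY V p.1 p.2 * pdY V p.1 p.2)) = 0 := by
    refine int_pdY (fun x Y => a11 Y * (pdY V x Y * V x Y))
      (fun x Y => deriv a11 Y * (pdY V x Y * V x Y) + a11 Y * (pdY (pdY V) x Y * V x Y)
        + a11 Y * (pdY V x Y * pdY V x Y)) ?_ (int_prod3 ca cY cV ba iY iV) iP ?_
    · intro x Y
      have := (sa.differentiable (by simp) Y).hasDerivAt.mul ((hV.smY.hasY x Y).mul (hV.hasY x Y))
      refine this.congr_deriv ?_
      simp only [Pi.mul_apply]; ring
    · intro x hx; simp [hb0 x ⟨hx.1.le, hx.2.le⟩]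
  -- energy, x part
  have iQ : IntegrableOn (fun p : ℝ × ℝ => a22 p.2 * (pdX (pdX V) p.1 p.2 * V p.1 p.2)
      + a22 p.2 * (pdX V p.1 p.2 * pdX V p.1 p.2)) (Om L) :=
    (int_prod3 cd cXX cV bd iXX iV).add (int_prod3 cd cX cX bd iX iX)
  have TQ : ∫ p in Om L, (a22 p.2 * (pdX (pdX V) p.1 p.2 * V p.1 p.2)
      + a22 p.2 * (pdX V p.1 p.2 * pdX V p.1 p.2)) = 0 := by
    refine int_pdX hL (fun x Y => a22 Y * (pdX V x Y * V x Y))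
      (fun x Y => a22 Y * (pdX (pdX V) x Y * V x Y) + a22 Y * (pdX V x Y * pdX V x Y))
      (by fun_prop) ?_ iQ ?_ ?_
    · intro x Y
      have := ((hV.smX.hasX x Y).mul (hV.hasX x Y)).const_mul (a22 Y)
      refine this.congr_deriv ?_
      ring
    · intro Y hY; simp [(hb Y hY.le).1]
    · intro Y hY; simp [(hb Y hY.le).2]
  -- second order identity
  have iR : IntegrableOn (fun p : ℝ × ℝ => pdX (pdY V) p.1 p.2 ^ 2
      - pdX (pdX V) p.1 p.2 * pdY (pdY V) p.1 p.2) (Om L) :=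
    iXY.sub (prod_int _ _ cXX cYY iXX iYY)
  have TR := key_identity hL V hV hb hb0 (prod_int _ _ cX cXY iX iXY) iR
  have iPQ := iP.add iQ
  have TPQ := integral_add iP iQ
  rw [TP, TQ] at TPQ
  have hrp : 0 < r := by rw [hr]; positivity
  have hκp : 0 < κ := by rw [hκ]; positivity
  -- integrated inequalities
  have e1 := lincomb7 iV iX iY iXX iXY iYY iG iT1 (1 / 2) (-(2 * L ^ 2)) 0 0 0 0 0 (by
    filter_upwards [hae] with p hp
    have := pt_poin (v := V p.1 p.2) (w := pdX V p.1 p.2) hp.1.1 hp.1.2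
    linarith)
  have e2 := lincomb7 iV iX iY iXX iXY iYY iG iPQ (-(1 / 2 + Cb + Cb ^ 2 / (2 * c0))) c0 (c0 / 2)
    0 0 0 (-(1 / 2)) (by
    filter_upwards [hae] with p hp
    have hcp := hc p.2
    have := pt_energy (vx := pdX V p.1 p.2) hc0 hcp.1 hcp.2.2.1 hcp.2.2.2.2 (hc' p.2).2.2 (he p hp)
    simp only [Pi.add_apply]
    linarith)
  have e3 := lincomb7 iV iX iY iXX iXY iYY iG iR (-(κ * Cb ^ 2)) 0 (-(κ * (2 * Cb ^ 2))) 0 1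
    (r / 2) (-κ) (by
    filter_upwards [hae] with p hp
    have hcp := hc p.2
    have := pt_h2 hc0 hCb0 hcp.1 hcp.2.2.1 hcp.2.2.2.1
      (pt_g (hc' p.2).1 hcp.2.2.2.2 (hc' p.2).2.2 (he p hp))
    rw [← hr, ← hκ] at this
    linarith)
  have e4 := lincomb7 (T := fun _ => 0) iV iX iY iXX iXY iYY iG (integrable_zero _ ℝ _) (-(8 * Cb ^ 2)) 0
    (-(16 * Cb ^ 2)) (c0 ^ 2) 0 (-(2 * Cb ^ 2)) (-8) (by
    filter_upwards [hae] with p hp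
    have hcp := hc p.2
    have := pt_xx hc0 hcp.1 hcp.2.1 hcp.2.2.1
      (pt_g (hc' p.2).1 hcp.2.2.2.2 (hc' p.2).2.2 (he p hp))
    linarith)
  have e5 := lincomb7 iV iX iY iXX iXY iYY iG iS.neg (-1) (-1) (-1) (-1) (-1) (-1) 0 (by
    filter_upwards with p
    simp only [Pi.neg_apply]
    linarith)
  rw [T1] at e1
  rw [TR] at e3
  simp only [Pi.add_apply, Pi.neg_apply, integral_neg, integral_zero] at e2 e4 e5
  rw [TPQ] at e2
  have nn : ∀ f : ℝ × ℝ → ℝ, 0 ≤ ∫ p in Om L, f p ^ 2 := fun f =>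
    integral_nonneg fun p => sq_nonneg _
  have hK : (1:ℝ) / 2 ≤ 1 / 2 + Cb + Cb ^ 2 / (2 * c0) := by
    have : 0 ≤ Cb ^ 2 / (2 * c0) := by positivity
    linarith
  have fin := final_arith (Cb := Cb) (N := ∫ p in Om L, pdX (pdX V) p.1 p.2 ^ 2)
    hc0 hrp hκp hK hL0 hh
    (nn fun p => pdY V p.1 p.2) (nn fun p => pdX V p.1 p.2) (nn fun p => V p.1 p.2)
    (nn fun p => pdY (pdY V) p.1 p.2) (nn fun p => pdX (pdY V) p.1 p.2)
    (nn fun p => pdY F p.1 p.2) (by linarith) (by linarith) (by linarith) (by linarith)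
  linarith

/-- `H²` elliptic regularity on the half-strip: for smooth uniformly
elliptic coefficients `a₁₁, a₂₂` (bounded above and below) and smooth bounded `b₁`
(with coefficient bounds `c₀, C_b`), there are `L₀ > 0` and `C > 0` depending only on
the coefficient bounds such that every smooth solution `V` of
`-∂_Y(a₁₁ ∂_Y V) - ∂_x(a₂₂ ∂_x V) + ∂_Y(b₁ V) = ∂_Y F` on `Ω = (0,L)×(0,∞)`, `L ≤ L₀`,
vanishing on `x = 0`, `x = L`, `Y = 0` and decaying together with its first and second
derivatives as `Y → ∞`, satisfies `‖V‖_{H²(Ω)} ≤ C (‖F‖_{L²(Ω)} + ‖∂_Y F‖_{L²(Ω)})`. -/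
theorem stmt_16 (c0 Cb : ℝ) (hc0 : 0 < c0) (hCb : c0 ≤ Cb) :
    ∃ L0 : ℝ, 0 < L0 ∧ ∃ C : ℝ, 0 < C ∧
      ∀ (L : ℝ) (a11 a22 b1 : ℝ → ℝ) (V F : ℝ → ℝ → ℝ),
        0 < L → L ≤ L0 →
        ContDiff ℝ (⊤ : ℕ∞) a11 → ContDiff ℝ (⊤ : ℕ∞) a22 → ContDiff ℝ (⊤ : ℕ∞) b1 →
        (∀ Y : ℝ, c0 ≤ a11 Y ∧ a11 Y ≤ Cb ∧ c0 ≤ a22 Y ∧ a22 Y ≤ Cb ∧ |b1 Y| ≤ Cb) →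
        (∀ Y : ℝ, |deriv a11 Y| ≤ Cb ∧ |deriv a22 Y| ≤ Cb ∧ |deriv b1 Y| ≤ Cb) →
        ContDiff ℝ (⊤ : ℕ∞) (Function.uncurry V) →
        ContDiff ℝ (⊤ : ℕ∞) (Function.uncurry F) →
        -- the elliptic equation on Ω
        (∀ x ∈ Ioo (0:ℝ) L, ∀ Y ∈ Ioi (0:ℝ),
          -(deriv (fun s => a11 s * deriv (V x) s) Y)
            - a22 Y * iteratedDeriv 2 (fun t => V t Y) x
            + deriv (fun s => b1 s * V x s) Y
          = deriv (F x) Y) →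
        -- homogeneous Dirichlet boundary conditions
        (∀ Y : ℝ, 0 ≤ Y → V 0 Y = 0 ∧ V L Y = 0) →
        (∀ x ∈ Icc (0:ℝ) L, V x 0 = 0) →
        -- decay of V, ∇V, ∇²V as Y → ∞
        (∀ x ∈ Icc (0:ℝ) L,
          Tendsto (V x) atTop (nhds 0) ∧
          Tendsto (deriv (V x)) atTop (nhds 0) ∧
          Tendsto (iteratedDeriv 2 (V x)) atTop (nhds 0) ∧
          Tendsto (fun Y => deriv (fun t => V t Y) x) atTop (nhds 0) ∧
          Tendsto (fun Y => deriv (fun t => deriv (V t) Y) x) atTop (nhds 0) ∧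
          Tendsto (fun Y => iteratedDeriv 2 (fun t => V t Y) x) atTop (nhds 0)) →
        -- finiteness of the right-hand side norms
        IntegrableOn (fun p : ℝ × ℝ => (F p.1 p.2) ^ 2) (Ioo (0:ℝ) L ×ˢ Ioi (0:ℝ)) →
        IntegrableOn (fun p : ℝ × ℝ => (deriv (F p.1) p.2) ^ 2)
          (Ioo (0:ℝ) L ×ˢ Ioi (0:ℝ)) →
        Real.sqrt (∫ p in Ioo (0:ℝ) L ×ˢ Ioi (0:ℝ),
            ((V p.1 p.2) ^ 2 + (deriv (fun t => V t p.2) p.1) ^ 2 + (deriv (V p.1) p.2) ^ 2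
              + (iteratedDeriv 2 (fun t => V t p.2) p.1) ^ 2
              + (deriv (fun t => deriv (V t) p.2) p.1) ^ 2
              + (iteratedDeriv 2 (V p.1) p.2) ^ 2)) ≤
          C * (Real.sqrt (∫ p in Ioo (0:ℝ) L ×ˢ Ioi (0:ℝ), (F p.1 p.2) ^ 2)
              + Real.sqrt (∫ p in Ioo (0:ℝ) L ×ˢ Ioi (0:ℝ), (deriv (F p.1) p.2) ^ 2)) := by
  have hCb0 : 0 < Cb := hc0.trans_le hCb
  obtain ⟨h, hh⟩ : ∃ h : ℝ, h = 1 + 2 * Cb ^ 2 / c0 + Cb ^ 2 := ⟨_, rfl⟩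
  obtain ⟨r, hr⟩ : ∃ r : ℝ, r = c0 / Cb := ⟨_, rfl⟩
  obtain ⟨κ, hκ⟩ : ∃ κ : ℝ, κ = 2 / (r * c0 ^ 2) := ⟨_, rfl⟩
  obtain ⟨K, hK⟩ : ∃ K : ℝ, K = 1 / 2 + Cb + Cb ^ 2 / (2 * c0) := ⟨_, rfl⟩
  have hhp : 0 < h := by rw [hh]; positivity
  have hrp : 0 < r := by rw [hr]; positivity
  have hκp : 0 < κ := by rw [hκ]; positivity
  have hKp : 0 < K := by rw [hK]; positivity
  obtain ⟨Q, hQ⟩ : ∃ Q : ℝ, Q = 1 + 1 / c0 + 1 / c0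
    + (8 * h + 2 * Cb ^ 2 * (2 * κ * h / r)) / c0 ^ 2 + κ * h + 2 * κ * h / r := ⟨_, rfl⟩
  have hQp : 0 < Q := by rw [hQ]; positivity
  refine ⟨Real.sqrt (c0 / (16 * K)), by positivity, Real.sqrt Q, by positivity, ?_⟩
  intro L a11 a22 b1 V F hL hLL sa sd sb hc hc' hV hF heq hb hb0 _ _ iG
  have hL2 : 16 * L ^ 2 * K ≤ c0 := by
    have h1 : L ^ 2 ≤ c0 / (16 * K) := by
      rw [← Real.sq_sqrt (show 0 ≤ c0 / (16 * K) by positivity)]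
      gcongr
    rw [le_div_iff₀ (by positivity)] at h1
    linarith
  have i2X : ∀ x Y : ℝ, iteratedDeriv 2 (fun t => V t Y) x = pdX (pdX V) x Y := by
    intro x Y
    rw [iteratedDeriv_succ, iteratedDeriv_one]; rfl
  have i2Y : ∀ x Y : ℝ, iteratedDeriv 2 (V x) Y = pdY (pdY V) x Y := by
    intro x Y
    rw [iteratedDeriv_succ, iteratedDeriv_one]; rfl
  simp only [i2X, i2Y] at heq ⊢
  change Real.sqrt (∫ p in Om L, (V p.1 p.2 ^ 2 + pdX V p.1 p.2 ^ 2 + pdY V p.1 p.2 ^ 2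
      + pdX (pdX V) p.1 p.2 ^ 2 + pdX (pdY V) p.1 p.2 ^ 2 + pdY (pdY V) p.1 p.2 ^ 2))
    ≤ Real.sqrt Q * (Real.sqrt (∫ p in Om L, F p.1 p.2 ^ 2)
      + Real.sqrt (∫ p in Om L, pdY F p.1 p.2 ^ 2))
  by_cases iS : IntegrableOn (fun p : ℝ × ℝ => V p.1 p.2 ^ 2 + pdX V p.1 p.2 ^ 2
      + pdY V p.1 p.2 ^ 2 + pdX (pdX V) p.1 p.2 ^ 2 + pdX (pdY V) p.1 p.2 ^ 2
      + pdY (pdY V) p.1 p.2 ^ 2) (Om L)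
  · have main := core_est hc0 hCb hL (by rw [← hK]; exact hL2) sa sd sb hc hc' hV heq hb hb0 iG iS
      hh hr hκ
    rw [← hQ] at main
    calc _ ≤ Real.sqrt (Q * ∫ p in Om L, pdY F p.1 p.2 ^ 2) := Real.sqrt_le_sqrt main
      _ = Real.sqrt Q * Real.sqrt (∫ p in Om L, pdY F p.1 p.2 ^ 2) := Real.sqrt_mul hQp.le _
      _ ≤ _ := by
        gcongr
        linarith [Real.sqrt_nonneg (∫ p in Om L, F p.1 p.2 ^ 2)]
  · rw [integral_undef iS, Real.sqrt_zero]
    positivity
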